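/- Let X be a nonempty irreducible (topologically transitive) one-step shift of finite type over a finite alphabet. Then LPS(X) is either a singleton {d} for some d ∈ ℕ, or equals dS for some positive integer d and some cofinite set S ⊆ ℕ. -/

import Mathlib

/-- The shift map on the full shift `A^ℤ`: `(σ x) i = x (i+1)`. -/
def shiftMap {A : Type*} : (ℤ → A) → (ℤ → A) := fun x i => x (i + 1)

/-- A one-step shift of finite type: the set of bi-infinite sequences all of whose
adjacent pairs lie in a relation `R ⊆ A × A`. -/
def IsOneStepSFT {A : Type*} (X : Set (ℤ → A)) : Prop :=
  ∃ R : Set (A × A), X = {x | ∀ i : ℤ, (x i, x (i + 1)) ∈ R}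

/-- The least period set of the shift restricted to a subset `X` of the full shift. -/
def LPSset {A : Type*} (X : Set (ℤ → A)) : Set ℕ :=
  {n | 0 < n ∧ ∃ x ∈ X, shiftMap^[n] x = x ∧ ∀ k, 0 < k → k < n → shiftMap^[k] x ≠ x}

/-- `S` is a cofinite subset of `ℕ = {1, 2, 3, ...}`. -/
def CofinitePos (S : Set ℕ) : Prop :=
  S ⊆ {n : ℕ | 0 < n} ∧ ({n : ℕ | 0 < n} \ S).Finite

/-- Topological transitivity of the shift restricted to a subset `X` of the full shift:
for all open `U, V` meeting `X` there is `n > 0` and a point of `X` in `U` whose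
`n`-th shift lies in `V`. -/
def TransitiveOn {A : Type*} [TopologicalSpace A] (X : Set (ℤ → A)) : Prop :=
  ∀ U V : Set (ℤ → A), IsOpen U → IsOpen V → (U ∩ X).Nonempty → (V ∩ X).Nonempty →
    ∃ n : ℕ, 0 < n ∧ ∃ x ∈ X, x ∈ U ∧ shiftMap^[n] x ∈ V

lemma shiftMap_iterate_apply {A : Type*} (n : ℕ) (x : ℤ → A) (i : ℤ) :
    shiftMap^[n] x i = x (i + n) := by
  induction n generalizing x i with
  | zero => simp
  | succ n ih =>
    rw [Function.iterate_succ_apply, ih]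
    simp only [shiftMap]
    congr 1
    push_cast
    ring

lemma isPeriodicPt_shiftMap_iff {A : Type*} {n : ℕ} {x : ℤ → A} :
    Function.IsPeriodicPt shiftMap n x ↔ Function.Periodic x (n : ℤ) := by
  constructor
  · intro h i
    rw [← shiftMap_iterate_apply n x i, h.eq]
  · intro h
    funext i
    rw [shiftMap_iterate_apply, h i]

lemma mem_LPSset_iff {A : Type*} {X : Set (ℤ → A)} {n : ℕ} :
    n ∈ LPSset X ↔ 0 < n ∧ ∃ x ∈ X, Function.minimalPeriod shiftMap x = n := by
  constructor
  · rintro ⟨hn, x, hx, hper, hmin⟩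
    refine ⟨hn, x, hx, ?_⟩
    have hper' : Function.IsPeriodicPt shiftMap n x := hper
    refine (hper'.minimalPeriod_le hn).antisymm (not_lt.1 fun hlt => ?_)
    exact hmin _ (hper'.minimalPeriod_pos hn) hlt (Function.iterate_minimalPeriod)
  · rintro ⟨hn, x, hx, rfl⟩
    exact ⟨hn, x, hx, Function.iterate_minimalPeriod, fun k hk hlt =>
      Function.not_isPeriodicPt_of_pos_of_lt_minimalPeriod hk.ne' hlt⟩

lemma Function.Periodic.apply_emod {A : Type*} {y : ℤ → A} {n : ℤ}
    (h : Function.Periodic y n) (i : ℤ) : y (i % n) = y i := by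
  rw [Int.emod_def, mul_comm]
  exact h.sub_int_mul_eq (i / n)

lemma Function.Periodic.eq_of_forall_lt {A : Type*} {y z : ℤ → A} {n : ℕ} (hn : 0 < n)
    (hy : Function.Periodic y (n : ℤ)) (hz : Function.Periodic z (n : ℤ))
    (h : ∀ j : ℕ, j < n → y j = z j) : y = z := by
  funext i
  rw [← hy.apply_emod, ← hz.apply_emod]
  have h0 := Int.emod_nonneg i (b := (n : ℤ)) (by lia)
  have h1 := Int.emod_lt_of_pos i (b := (n : ℤ)) (by lia)
  have := h (i % n).toNat (by lia)
  rwa [Int.toNat_of_nonneg h0] at this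

/-- The first `n` steps of the sequence `f` form a walk in the graph with edge set `R`. -/
def IsWalk {A : Type*} (R : Set (A × A)) (f : ℕ → A) (n : ℕ) : Prop :=
  ∀ i < n, (f i, f (i + 1)) ∈ R

lemma isWalk_of_forall_mem {A : Type*} {R : Set (A × A)} {x : ℤ → A}
    (hx : ∀ i : ℤ, (x i, x (i + 1)) ∈ R) (n : ℕ) : IsWalk R (fun i => x i) n := by
  intro i _
  simpa using hx i

lemma IsWalk.exists_append {A : Type*} {R : Set (A × A)} {f g : ℕ → A} {m n : ℕ}
    (hf : IsWalk R f m) (hg : IsWalk R g n) (h : f m = g 0) :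
    ∃ w : ℕ → A, IsWalk R w (m + n) ∧ (∀ i ≤ m, w i = f i) ∧ ∀ j, w (m + j) = g j := by
  have hleft : ∀ i ≤ m, (if i < m then f i else g (i - m)) = f i := by
    intro i hi
    rcases hi.lt_or_eq with hi | rfl
    · simp [hi]
    · simp [h]
  refine ⟨fun i => if i < m then f i else g (i - m), fun i hi => ?_, hleft, by simp⟩
  rcases lt_or_ge i m with him | him
  · beta_reduce
    rw [hleft i him.le, hleft (i + 1) him]
    exact hf i him
  · obtain ⟨j, rfl⟩ := Nat.exists_eq_add_of_le him
    simpa [add_assoc] using hg j (by lia)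

lemma IsWalk.exists_periodic {A : Type*} {R : Set (A × A)} {f : ℕ → A} {n : ℕ}
    (hf : IsWalk R f n) (hn : 0 < n) (h : f n = f 0) :
    ∃ y : ℤ → A, (∀ i : ℤ, (y i, y (i + 1)) ∈ R) ∧ Function.Periodic y (n : ℤ) ∧
      ∀ j ≤ n, y (j : ℤ) = f j := by
  refine ⟨fun i => f (i % n).toNat, fun i => ?_, fun i => by simp, fun j hj => ?_⟩
  · beta_reduce
    have h0 := Int.emod_nonneg i (b := (n : ℤ)) (by lia)
    have h1 := Int.emod_lt_of_pos i (b := (n : ℤ)) (by lia)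
    have hstep := hf (i % n).toNat (by lia)
    have hmod : (i + 1) % (n : ℤ) = (i % n + 1) % n := by simp
    rcases (show i % (n : ℤ) + 1 ≤ n by lia).lt_or_eq with hlt | heq
    · have : ((i + 1) % (n : ℤ)).toNat = (i % n).toNat + 1 := by
        rw [hmod, Int.emod_eq_of_lt (by lia) hlt]
        lia
      rwa [this]
    · have h2 : ((i + 1) % (n : ℤ)).toNat = 0 := by
        rw [hmod, heq]
        simp
      have h3 : (i % (n : ℤ)).toNat + 1 = n := by lia
      rwa [h3, h, ← h2] at hstep
  · rcases hj.lt_or_eq with hlt | rfl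
    · have : ((j : ℤ) % n).toNat = j := by
        rw [Int.emod_eq_of_lt (by lia) (by lia)]
        simp
      simp only [this]
    · simp [h]

/-- The lengths of closed walks based at the vertex `a`. -/
def closedWalkLengths {A : Type*} (R : Set (A × A)) (a : A) : AddSubmonoid ℕ where
  carrier := {n | ∃ f, IsWalk R f n ∧ f 0 = a ∧ f n = a}
  zero_mem' := ⟨fun _ => a, fun i hi => absurd hi (Nat.not_lt_zero i), rfl, rfl⟩
  add_mem' := by
    rintro m n ⟨f, hf, hf0, hfm⟩ ⟨g, hg, hg0, hgn⟩
    obtain ⟨w, hw, hwf, hwg⟩ := hf.exists_append hg (hfm.trans hg0.symm)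
    exact ⟨w, hw, (hwf 0 m.zero_le).trans hf0, (hwg n).trans hgn⟩

lemma mem_closedWalkLengths {A : Type*} {R : Set (A × A)} {a : A} {n : ℕ} :
    n ∈ closedWalkLengths R a ↔ ∃ f, IsWalk R f n ∧ f 0 = a ∧ f n = a :=
  Iff.rfl

/-- Following a periodic sequence `x` for a long time and then a closed walk which deviates from
`x` produces a sequence whose least period is the total length. -/
lemma minimalPeriod_eq_of_agree_of_ne {A : Type*} {x y : ℤ → A} {p K n j : ℕ} (hp : 0 < p)
    (hx : Function.Periodic x (p : ℤ)) (hn : 0 < n) (hy : Function.Periodic y (n : ℤ))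
    (hpK : p ∣ K) (hK : n + 2 * p ≤ 2 * K) (hagree : ∀ i : ℕ, i ≤ K → y i = x i)
    (hne : y ((K + j : ℕ) : ℤ) ≠ x j) : Function.minimalPeriod shiftMap y = n := by
  have hyn : Function.IsPeriodicPt shiftMap n y := isPeriodicPt_shiftMap_iff.2 hy
  by_contra hcon
  obtain ⟨c, hc⟩ := hyn.minimalPeriod_dvd
  have hq0 := hyn.minimalPeriod_pos hn
  have hq := isPeriodicPt_shiftMap_iff.1 (Function.isPeriodicPt_minimalPeriod shiftMap y)
  generalize Function.minimalPeriod shiftMap y = q at *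
  have hc2 : 2 ≤ c := by
    rcases c with _ | _ | c
    · lia
    · simp at hc
      lia
    · lia
  have hqn : 2 * q ≤ n := by nlinarith
  have hyp : Function.Periodic y (p : ℤ) := by
    have : (fun i => y (i + p)) = y := by
      refine Function.Periodic.eq_of_forall_lt hq0 (fun i => ?_) hq fun i hi => ?_
      · simpa [add_right_comm] using hq (i + p)
      · have := hagree (i + p) (by lia)
        push_cast at this
        rw [this, hx, hagree i (by lia)]
    exact fun i => congrFun this i
  have hyx : y = x :=
    Function.Periodic.eq_of_forall_lt hp hyp hx fun i hi => hagree i (by lia)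
  obtain ⟨k, rfl⟩ := hpK
  apply hne
  rw [hyx]
  have := hx.nat_mul k (j : ℤ)
  rw [← this]
  congr 1
  push_cast
  ring

/-- If some closed walk at `x 0` deviates from the periodic point `x`, then every large enough
multiple of the period of the graph is a least period. -/
lemma exists_forall_ge_mem_LPSset {A : Type*} {R : Set (A × A)} {x : ℤ → A} {p l : ℕ}
    {v : ℕ → A} (hp : 0 < p) (hxR : ∀ i : ℤ, (x i, x (i + 1)) ∈ R)
    (hx : Function.Periodic x (p : ℤ)) (hv : IsWalk R v l) (hv0 : v 0 = x 0) (hvl : v l = x 0)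
    (hne : ∃ j ≤ l, v j ≠ x j) :
    ∃ N, ∀ n ≥ N, Nat.setGcd (closedWalkLengths R (x 0) : Set ℕ) ∣ n →
      n ∈ LPSset {x : ℤ → A | ∀ i : ℤ, (x i, x (i + 1)) ∈ R} := by
  have hwalk (k : ℕ) : ((p * k : ℕ) : ℤ) = 0 + (k : ℕ) * (p : ℤ) := by
    push_cast
    ring
  have hxk (k : ℕ) : x ((p * k : ℕ) : ℤ) = x 0 := by
    rw [hwalk]
    exact hx.nat_mul k 0
  have hpmem : p ∈ closedWalkLengths R (x 0) :=
    ⟨fun i => x i, isWalk_of_forall_mem hxR p, rfl, by simpa using hxk 1⟩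
  have hlmem : l ∈ closedWalkLengths R (x 0) := ⟨v, hv, hv0, hvl⟩
  obtain ⟨M, hM⟩ := Nat.exists_mem_closure_of_ge (closedWalkLengths R (x 0) : Set ℕ)
  rw [AddSubmonoid.closure_eq] at hM
  refine ⟨2 * l + 2 * M + 5 * p, fun n hn hd => ?_⟩
  set k := (n - l - M) / p with hk
  set r := n - l - p * k with hr
  have h1 : p * k ≤ n - l - M := Nat.mul_div_le _ _
  have h2 : n - l - M < p * k + p := by
    have := Nat.lt_mul_div_succ (n - l - M) hp
    rwa [← hk, mul_add, mul_one] at this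
  have hsum : n = p * k + (l + r) := by lia
  have hrmem : r ∈ closedWalkLengths R (x 0) := by
    refine hM r (by lia) ?_
    exact Nat.dvd_sub (Nat.dvd_sub hd (Nat.setGcd_dvd_of_mem hlmem))
      ((Nat.setGcd_dvd_of_mem hpmem).mul_right k)
  obtain ⟨g, hg, hg0, hgr⟩ := hrmem
  obtain ⟨w, hw, hwv, hwg⟩ := hv.exists_append hg (hvl.trans hg0.symm)
  have hw0 : w 0 = x 0 := (hwv 0 l.zero_le).trans hv0
  obtain ⟨f, hf, hfx, hfw⟩ :=
    (isWalk_of_forall_mem hxR (p * k)).exists_append hw ((hxk k).trans hw0.symm)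
  rw [← hsum] at hf
  have hn0 : 0 < n := by lia
  have hfn : f n = f 0 := by
    rw [hsum, hfw, hwg, hgr, hfx 0 (Nat.zero_le _)]
    rfl
  obtain ⟨y, hyR, hyper, hyf⟩ := hf.exists_periodic hn0 hfn
  obtain ⟨j, hj, hjne⟩ := hne
  refine mem_LPSset_iff.2 ⟨hn0, y, hyR, ?_⟩
  refine minimalPeriod_eq_of_agree_of_ne (j := j) hp hx hn0 hyper (dvd_mul_right p k) (by lia)
    (fun i hi => ?_) ?_
  · rw [hyf i (by lia), hfx i hi]
  · rwa [hyf _ (by lia), hfw, hwv j hj]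

lemma TransitiveOn.exists_isWalk {A : Type*} [TopologicalSpace A] [DiscreteTopology A]
    {R : Set (A × A)} (h : TransitiveOn {x : ℤ → A | ∀ i : ℤ, (x i, x (i + 1)) ∈ R})
    {x z : ℤ → A} (hx : ∀ i : ℤ, (x i, x (i + 1)) ∈ R) (hz : ∀ i : ℤ, (z i, z (i + 1)) ∈ R) :
    ∃ (f : ℕ → A) (n : ℕ), 0 < n ∧ IsWalk R f n ∧ f 0 = x 0 ∧ f n = z 0 := by
  have hopen (a : A) : IsOpen {u : ℤ → A | u 0 = a} :=
    (isOpen_discrete ({a} : Set A)).preimage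
      (continuous_apply (A := fun _ : ℤ => A) (0 : ℤ))
  obtain ⟨n, hn, y, hy, hyx, hyz⟩ :=
    h _ _ (hopen (x 0)) (hopen (z 0)) ⟨x, rfl, hx⟩ ⟨z, rfl, hz⟩
  refine ⟨fun i => y i, n, hn, isWalk_of_forall_mem hy n, hyx, ?_⟩
  have hshift : shiftMap^[n] y 0 = z 0 := hyz
  simpa [shiftMap_iterate_apply] using hshift

/-- The least period set of a nonempty irreducible one-step SFT is either a singleton
`{d}` or of the form `dS` with `S` cofinite. -/
theorem LPS_of_irreducible_SFT {A : Type*} [Fintype A] [TopologicalSpace A]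
    [DiscreteTopology A] (X : Set (ℤ → A)) (hSFT : IsOneStepSFT X) (hne : X.Nonempty)
    (hirr : TransitiveOn X) :
    (∃ d : ℕ, LPSset X = {d}) ∨
    (∃ (d : ℕ) (S : Set ℕ), 0 < d ∧ CofinitePos S ∧
      LPSset X = (fun s => d * s) '' S) := by
  obtain ⟨R, rfl⟩ := hSFT
  obtain ⟨x₀, hx₀⟩ := hne
  obtain ⟨f, p, hp, hf, hf0, hfp⟩ := hirr.exists_isWalk hx₀ hx₀
  obtain ⟨x, hxR, hxp, hxf⟩ := hf.exists_periodic hp (hfp.trans hf0.symm)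
  by_cases hdev : ∃ (l : ℕ) (v : ℕ → A), IsWalk R v l ∧ v 0 = x 0 ∧ v l = x 0 ∧
      ∃ j ≤ l, v j ≠ x j
  · right
    obtain ⟨l, v, hv, hv0, hvl, hne⟩ := hdev
    obtain ⟨N, hN⟩ := exists_forall_ge_mem_LPSset hp hxR hxp hv hv0 hvl hne
    set d := Nat.setGcd (closedWalkLengths R (x 0) : Set ℕ) with hd
    have hd0 : 0 < d := by
      refine Nat.pos_of_dvd_of_pos (Nat.setGcd_dvd_of_mem (n := p) ?_) hp
      exact ⟨fun i => x i, isWalk_of_forall_mem hxR p, rfl, by simpa using hxp 0⟩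
    have hdvd : ∀ n ∈ LPSset {x : ℤ → A | ∀ i : ℤ, (x i, x (i + 1)) ∈ R}, d ∣ n := by
      intro n hn
      obtain ⟨hn0, z, hz, hzn⟩ := mem_LPSset_iff.1 hn
      have hzper := isPeriodicPt_shiftMap_iff.1 (Function.isPeriodicPt_minimalPeriod shiftMap z)
      rw [hzn] at hzper
      obtain ⟨g, s, -, hg, hg0, hgs⟩ := hirr.exists_isWalk hxR hz
      obtain ⟨h, t, -, hh, hh0, hht⟩ := hirr.exists_isWalk hz hxR
      have hzn0 : z (n : ℤ) = z 0 := by simpa using hzper 0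
      obtain ⟨w, hw, hwz, hwh⟩ :=
        (isWalk_of_forall_mem hz n).exists_append hh (hzn0.trans hh0.symm)
      obtain ⟨w₁, hw₁, hw₁g, hw₁h⟩ := hg.exists_append hh (hgs.trans hh0.symm)
      obtain ⟨w₂, hw₂, hw₂g, hw₂w⟩ :=
        hg.exists_append hw (hgs.trans (hwz 0 n.zero_le).symm)
      have h₁ : s + t ∈ closedWalkLengths R (x 0) :=
        ⟨w₁, hw₁, (hw₁g 0 s.zero_le).trans hg0, (hw₁h t).trans hht⟩
      have h₂ : s + (n + t) ∈ closedWalkLengths R (x 0) :=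
        ⟨w₂, hw₂, (hw₂g 0 s.zero_le).trans hg0, by rw [hw₂w, hwh, hht]⟩
      have h₃ : s + (n + t) - (s + t) = n := by lia
      rw [← h₃]
      exact Nat.dvd_sub (Nat.setGcd_dvd_of_mem h₂) (Nat.setGcd_dvd_of_mem h₁)
    refine ⟨d, {s | d * s ∈ LPSset {x : ℤ → A | ∀ i : ℤ, (x i, x (i + 1)) ∈ R}}, hd0,
      ⟨fun s hs => pos_of_mul_pos_right hs.1 d.zero_le, ?_⟩, ?_⟩
    · refine (Set.finite_Iio N).subset fun s hs => ?_
      refine Set.mem_Iio.2 <| not_le.1 fun hNs : N ≤ s => hs.2 (hN (d * s) ?_ (dvd_mul_right d s))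
      exact hNs.trans (Nat.le_mul_of_pos_left s hd0)
    · ext n
      constructor
      · intro hn
        obtain ⟨s, rfl⟩ := hdvd n hn
        exact ⟨s, hn, rfl⟩
      · rintro ⟨s, hs, rfl⟩
        exact hs
  · left
    push Not at hdev
    refine ⟨Function.minimalPeriod shiftMap x, Set.eq_singleton_iff_unique_mem.2 ⟨?_, ?_⟩⟩
    · exact mem_LPSset_iff.2
        ⟨(isPeriodicPt_shiftMap_iff.2 hxp).minimalPeriod_pos hp, x, hxR, rfl⟩
    intro m hm
    obtain ⟨hm0, z, hz, rfl⟩ := mem_LPSset_iff.1 hm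
    have hzm := isPeriodicPt_shiftMap_iff.1 (Function.isPeriodicPt_minimalPeriod shiftMap z)
    generalize hmz : Function.minimalPeriod shiftMap z = m at *
    obtain ⟨g, s, -, hg, hg0, hgs⟩ := hirr.exists_isWalk hxR hz
    obtain ⟨h, t, -, hh, hh0, hht⟩ := hirr.exists_isWalk hz hxR
    have hzper : Function.Periodic z ((m * p : ℕ) : ℤ) := by
      have := hzm.nat_mul p
      rwa [mul_comm, ← Nat.cast_mul] at this
    have hxper : Function.Periodic x ((m * p : ℕ) : ℤ) := by
      have := hxp.nat_mul m
      rwa [← Nat.cast_mul] at this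
    have hz0 : z ((m * p : ℕ) : ℤ) = z 0 := by simpa only [zero_add] using hzper 0
    obtain ⟨w, hw, hwz, hwh⟩ :=
      (isWalk_of_forall_mem hz (m * p)).exists_append hh (hz0.trans hh0.symm)
    obtain ⟨w₂, hw₂, hw₂g, hw₂w⟩ :=
      hg.exists_append hw (hgs.trans (hwz 0 (Nat.zero_le _)).symm)
    have hfollow := hdev _ w₂ hw₂ ((hw₂g 0 s.zero_le).trans hg0) (by rw [hw₂w, hwh, hht])
    have hzx : z = shiftMap^[s] x := by
      refine Function.Periodic.eq_of_forall_lt (Nat.mul_pos hm0 hp) hzper (fun i => ?_)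
        fun j hj => ?_
      · rw [shiftMap_iterate_apply, shiftMap_iterate_apply, add_right_comm, hxper]
      · have := hfollow (s + j) (by lia)
        rw [hw₂w, hwz j hj.le] at this
        rw [shiftMap_iterate_apply, add_comm, ← Nat.cast_add]
        exact this
    rw [← hmz, hzx]
    exact Function.minimalPeriod_apply_iterate ⟨p, hp, isPeriodicPt_shiftMap_iff.2 hxp⟩ s
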